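/- Let B be an even simple Bratteli diagram with full group G=G_B and path space X=X_B, let r≥1, let W_r denote the collection of all r-element subsets of X, let Z_r⊆W_r consist of those x̄∈W_r whose points lie in pairwise distinct G-orbits, and let X_{r-1} denote the collection of finite subsets of X of cardinality at most r-1. If φ is an ergodic atomless invariant random subgroup of G such that φ(⋃_{x̄∈X_{r-1}} F(x̄)) = 0, then φ(⋃_{x̄∈W_r∖Z_r} F(x̄)) = 0. -/

import Mathlib

open MeasureTheory Filter
open scoped ENNReal ComplexOrder

noncomputable section

/-- A Bratteli diagram: vertex levels `V i`, edge levels `E i` (edges from `V i` to `V (i+1)`),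
all levels finite and nonempty, a single root vertex, and source/range maps that are
surjective (every vertex emits and receives an edge). -/
structure BratteliDiagram where
  V : ℕ → Type
  E : ℕ → Type
  fintypeV : ∀ i, Fintype (V i)
  fintypeE : ∀ i, Fintype (E i)
  nonemptyV : ∀ i, Nonempty (V i)
  nonemptyE : ∀ i, Nonempty (E i)
  subsingleton_root : Subsingleton (V 0)
  src : ∀ i, E i → V i
  rng : ∀ i, E i → V (i + 1)
  src_surj : ∀ i, Function.Surjective (src i)
  rng_surj : ∀ i, Function.Surjective (rng i)

namespace BratteliDiagram

variable (B : BratteliDiagram)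

/-- The path space `X_B`: infinite paths starting at the root. -/
def Path : Type :=
  { x : ∀ i, B.E i // ∀ i, B.rng i (x i) = B.src (i + 1) (x (i + 1)) }

instance (i : ℕ) : UniformSpace (B.E i) := ⊥

instance instUniformSpacePath : UniformSpace B.Path :=
  inferInstanceAs (UniformSpace { x : ∀ i, B.E i // ∀ i, B.rng i (x i) = B.src (i + 1) (x (i + 1)) })

instance instMeasurableSpacePath : MeasurableSpace B.Path := borel _

/-- Finite segments of `L+1` consecutive edges starting at level `n`. -/
def Seg (n L : ℕ) : Type :=
  { f : ∀ i : Fin (L + 1), B.E (n + (i : ℕ)) //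
    ∀ (i : ℕ) (hi : i < L),
      B.rng (n + i) (f ⟨i, by omega⟩) = B.src (n + (i + 1)) (f ⟨i + 1, by omega⟩) }

/-- The number of finite paths connecting `v ∈ V n` to `w ∈ V (n + L + 1)`. -/
def numPaths (n L : ℕ) (v : B.V n) (w : B.V (n + L + 1)) : ℕ :=
  Nat.card { f : B.Seg n L //
    B.src n (f.1 ⟨0, by omega⟩) = v ∧ B.rng (n + L) (f.1 ⟨L, by omega⟩) = w }

/-- A Bratteli diagram is simple if every vertex of a given level is connected
to every vertex of some deeper level. -/
def IsSimple : Prop :=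
  ∀ n : ℕ, ∃ L : ℕ, ∀ (v : B.V n) (w : B.V (n + L + 1)), 0 < B.numPaths n L v w

/-- A Bratteli diagram is even if every vertex of a given level is connected to every
vertex of some deeper level by a (positive) even number of paths. -/
def IsEven : Prop :=
  ∀ n : ℕ, ∃ L : ℕ, ∀ (v : B.V n) (w : B.V (n + L + 1)),
    0 < B.numPaths n L v w ∧ Even (B.numPaths n L v w)

/-- A permutation of the path space "of level `n`": it changes only the first `n` edges,
and what it does to the first `n` edges depends only on the first `n` edges. -/
def IsLevel (n : ℕ) (g : Equiv.Perm B.Path) : Prop :=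
  (∀ (x : B.Path) (i : ℕ), n ≤ i → (g x).1 i = x.1 i) ∧
  (∀ x y : B.Path, (∀ i : ℕ, i < n → x.1 i = y.1 i) → ∀ i : ℕ, i < n → (g x).1 i = (g y).1 i)

theorem isLevel_one (n : ℕ) : B.IsLevel n 1 :=
  ⟨fun _ _ _ => rfl, fun _ _ h i hi => h i hi⟩

theorem IsLevel.mul {n : ℕ} {a b : Equiv.Perm B.Path} (ha : B.IsLevel n a)
    (hb : B.IsLevel n b) : B.IsLevel n (a * b) := by
  constructor
  · intro x i hi
    have h1 := ha.1 (b x) i hi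
    have h2 := hb.1 x i hi
    simpa [Equiv.Perm.mul_apply] using h1.trans h2
  · intro x y hxy i hi
    have h2 := hb.2 x y hxy
    have := ha.2 (b x) (b y) h2 i hi
    simpa [Equiv.Perm.mul_apply] using this

theorem IsLevel.mono {n m : ℕ} (hnm : n ≤ m) {g : Equiv.Perm B.Path}
    (h : B.IsLevel n g) : B.IsLevel m g := by
  refine ⟨fun x i hi => h.1 x i (hnm.trans hi), fun x y hxy i hi => ?_⟩
  rcases lt_or_ge i n with h' | h'
  · exact h.2 x y (fun j hj => hxy j (hj.trans_le hnm)) i h'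
  · rw [h.1 x i h', h.1 y i h']
    exact hxy i hi

/-- The group `G_n` of homeomorphisms of the path space permuting only the
first `n` edges of infinite paths. -/
def level (n : ℕ) : Subgroup (Equiv.Perm B.Path) where
  carrier := { g | B.IsLevel n g ∧ B.IsLevel n g⁻¹ }
  one_mem' := ⟨B.isLevel_one n, by simpa using B.isLevel_one n⟩
  mul_mem' := by
    intro a b ha hb
    exact ⟨ha.1.mul B hb.1, by rw [mul_inv_rev]; exact IsLevel.mul B hb.2 ha.2⟩
  inv_mem' := by
    intro a ha
    exact ⟨ha.2, by simpa using ha.1⟩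

theorem level_mono {n m : ℕ} (h : n ≤ m) : B.level n ≤ B.level m := by
  intro g hg
  exact ⟨hg.1.mono B h, hg.2.mono B h⟩

/-- The full group `G_B = ⋃ n, G_n` of the Bratteli diagram. -/
def fullGroup : Subgroup (Equiv.Perm B.Path) where
  carrier := { g | ∃ n, g ∈ B.level n }
  one_mem' := ⟨0, one_mem _⟩
  mul_mem' := by
    rintro a b ⟨n, ha⟩ ⟨m, hb⟩
    exact ⟨max n m, mul_mem (B.level_mono (le_max_left n m) ha)
      (B.level_mono (le_max_right n m) hb)⟩
  inv_mem' := by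
    rintro a ⟨n, ha⟩
    exact ⟨n, inv_mem ha⟩

/-- `G_n` viewed as a subgroup of the full group. -/
def levelIn (n : ℕ) : Subgroup ↥B.fullGroup := (B.level n).comap B.fullGroup.subtype

/-- The subgroup `G°(A)` of elements of the full group fixing `A` pointwise. -/
def Gcirc (A : Set B.Path) : Subgroup ↥B.fullGroup :=
  ⨅ x ∈ A, MulAction.stabilizer ↥B.fullGroup x

/-- `G°_n(A) = G_n ∩ G°(A)`. -/
def GcircN (n : ℕ) (A : Set B.Path) : Subgroup ↥B.fullGroup :=
  B.levelIn n ⊓ B.Gcirc A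

end BratteliDiagram

/-- Conjugation of a subgroup: `g • H = gHg⁻¹`. -/
def conjSub {Γ : Type*} [Group Γ] (g : Γ) (H : Subgroup Γ) : Subgroup Γ :=
  Subgroup.map (MulAut.conj g).toMonoidHom H

/-- The Borel structure on the space `Sub(Γ)` of subgroups of `Γ`,
induced from the product space `{0,1}^Γ` (equivalently `Set Γ`). -/
instance subgroupMeasurableSpace {Γ : Type*} [Group Γ] : MeasurableSpace (Subgroup Γ) :=
  MeasurableSpace.comap (fun H => (H : Set Γ)) inferInstance

namespace BratteliDiagram

variable (B : BratteliDiagram)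

/-- `F(A)`: the collection of subgroups of the full group normalized by `G°(A)`. -/
def FF (A : Set B.Path) : Set (Subgroup ↥B.fullGroup) :=
  { H | ∀ g ∈ B.Gcirc A, conjSub g H = H }

end BratteliDiagram

/-- A measure `ν` on `Y` is invariant under the action of `G`. -/
def MeasInv (G : Type*) [Group G] {Y : Type*} [MeasurableSpace Y] [MulAction G Y]
    (ν : Measure Y) : Prop :=
  ∀ (g : G) (s : Set Y), MeasurableSet s → ν ((fun y => g • y) ⁻¹' s) = ν s

/-- The action of `G` on `(Y, ν)` is ergodic: every invariant measurable set is null or conull. -/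
def MeasErg (G : Type*) [Group G] {Y : Type*} [MeasurableSpace Y] [MulAction G Y]
    (ν : Measure Y) : Prop :=
  ∀ s : Set Y, MeasurableSet s → (∀ g : G, (fun y => g • y) ⁻¹' s = s) → ν s = 0 ∨ ν s = 1

/-- An invariant random subgroup: a conjugation-invariant Borel probability measure on `Sub(G)`. -/
def IsIRS (G : Type*) [Group G] (φ : Measure (Subgroup G)) : Prop :=
  IsProbabilityMeasure φ ∧
    ∀ (g : G) (s : Set (Subgroup G)), MeasurableSet s → φ (conjSub g ⁻¹' s) = φ s

/-- An ergodic invariant random subgroup. -/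
def IsErgodicIRS (G : Type*) [Group G] (φ : Measure (Subgroup G)) : Prop :=
  IsIRS G φ ∧
    ∀ s : Set (Subgroup G), MeasurableSet s → (∀ g : G, conjSub g ⁻¹' s = s) →
      φ s = 0 ∨ φ s = 1

/-- A character of a group: normalized, central, positive semidefinite complex function. -/
def IsCharacter (G : Type*) [Group G] (χ : G → ℂ) : Prop :=
  χ 1 = 1 ∧ (∀ a b : G, χ (a * b) = χ (b * a)) ∧
    ∀ (n : ℕ) (g : Fin n → G) (c : Fin n → ℂ),
      0 ≤ ∑ i, ∑ j, (starRingEnd ℂ) (c i) * c j * χ (g i * (g j)⁻¹)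

namespace BratteliDiagram

variable (B : BratteliDiagram)

/-- The product measure `μ_α = μ_1^{α_1} × ⋯ × μ_k^{α_k}` on `X^{|α|}`,
realized on the index type `Σ i : Fin k, Fin (α i)` (of cardinality `|α| = Σ α i`). -/
def prodMeasure {k : ℕ} (μ : Fin k → Measure B.Path) (α : Fin k → ℕ) :
    Measure ((Σ i : Fin k, Fin (α i)) → B.Path) :=
  Measure.pi fun p => μ p.1

/-- The stabilizer distribution `φ_α` of the diagonal action of the full group
on `(X^{|α|}, μ_α)`. -/
def stabDist {k : ℕ} (μ : Fin k → Measure B.Path) (α : Fin k → ℕ) :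
    Measure (Subgroup ↥B.fullGroup) :=
  Measure.map (fun y => MulAction.stabilizer ↥B.fullGroup y) (B.prodMeasure μ α)

end BratteliDiagram

/-! ### Abstract finite combinatorics -/

section Core

variable {P V : Type*} (v : P → V)

/-- Permutations of `P` preserving the labelling `v`. -/
def permA : Subgroup (Equiv.Perm P) where
  carrier := { σ | ∀ p, v (σ p) = v p }
  one_mem' := fun _ => rfl
  mul_mem' := by
    intro a b ha hb p
    have h1 : v (a (b p)) = v (b p) := ha (b p)
    exact h1.trans (hb p)
  inv_mem' := by
    intro a ha p
    have h1 := ha (a⁻¹ p)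
    simpa using h1.symm

variable {G : Type*} [Group G]

theorem conjSub_mul (g h : G) (H : Subgroup G) :
    conjSub (g * h) H = conjSub g (conjSub h H) := by
  unfold conjSub
  rw [Subgroup.map_map]
  congr 1
  ext x
  simp

theorem conjSub_one (H : Subgroup G) : conjSub (1 : G) H = H := by
  unfold conjSub
  ext x
  simp

theorem mem_conjSub (g x : G) (H : Subgroup G) : x ∈ conjSub g H ↔ g⁻¹ * x * g ∈ H := by
  unfold conjSub
  rw [Subgroup.mem_map]
  constructor
  · rintro ⟨y, hy, rfl⟩
    simpa [mul_assoc] using hy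
  · intro h
    exact ⟨_, h, by simp [mul_assoc]⟩

theorem conjSub_inv_fix {g : G} {H : Subgroup G} (h : conjSub g H = H) :
    conjSub g⁻¹ H = H := by
  conv_lhs => rw [← h]
  rw [← conjSub_mul, inv_mul_cancel, conjSub_one]

theorem measurableSet_memSub (x : G) : MeasurableSet {H : Subgroup G | x ∈ H} := by
  refine ⟨{s : Set G | x ∈ s}, ?_, rfl⟩
  exact measurableSet_setOf.2 (measurable_set_mem x)

theorem measurableSet_fix [Countable G] (g : G) :
    MeasurableSet {H : Subgroup G | conjSub g H = H} := by
  have : {H : Subgroup G | conjSub g H = H} =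
      ⋂ x : G, {H : Subgroup G | g⁻¹ * x * g ∈ H ↔ x ∈ H} := by
    ext H
    simp only [Set.mem_ofPred_eq, Set.mem_iInter, SetLike.ext_iff, mem_conjSub]
  rw [this]
  refine MeasurableSet.iInter fun x => ?_
  exact MeasurableSet.iff (measurableSet_memSub _) (measurableSet_memSub _)

variable (L : permA v →* G)

/-- Subgroups normalized by all the label preserving permutations fixing `a`. -/
def FA (a : Finset P) : Set (Subgroup G) :=
  { H | ∀ σ : permA v, (∀ p ∈ a, σ.1 p = p) → conjSub (L σ) H = H }

theorem FA_mono {a b : Finset P} (h : a ⊆ b) : FA v L a ⊆ FA v L b :=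
  fun _ hH σ hσ => hH σ fun p hp => hσ p (h hp)

theorem measurableSet_FA [Finite P] [Countable G] (a : Finset P) : MeasurableSet (FA v L a) := by
  have : FA v L a = ⋂ (σ : permA v) (_ : ∀ p ∈ a, σ.1 p = p),
      {H : Subgroup G | conjSub (L σ) H = H} := by
    ext H; simp [FA]
  rw [this]
  exact MeasurableSet.iInter fun σ => MeasurableSet.iInter fun _ => measurableSet_fix _

variable [DecidableEq P]

theorem FA_conj (a : Finset P) (τ : permA v) (H : Subgroup G) :
    conjSub (L τ) H ∈ FA v L (a.image τ.1) ↔ H ∈ FA v L a := by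
  constructor
  · intro h σ hσ
    have := h (τ * σ * τ⁻¹) (by
      intro p hp
      obtain ⟨q, hq, rfl⟩ := Finset.mem_image.1 hp
      simp [hσ q hq])
    rw [← conjSub_mul, ← map_mul] at this
    have h2 := congrArg (conjSub (L τ⁻¹)) this
    rw [← conjSub_mul, ← conjSub_mul, ← map_mul, ← map_mul] at h2
    simpa [mul_assoc, conjSub_one] using h2
  · intro h σ hσ
    have := h (τ⁻¹ * σ * τ) (by
      intro p hp
      have := hσ (τ.1 p) (Finset.mem_image_of_mem _ hp)
      simp [this])
    have h2 := congrArg (conjSub (L τ)) this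
    rw [← conjSub_mul, ← map_mul] at h2
    rw [← conjSub_mul, ← map_mul]
    simpa [mul_assoc] using h2

/-- A label preserving transposition. -/
def swA (p q : P) (h : v p = v q) : permA v :=
  ⟨Equiv.swap p q, by
    intro x
    by_cases h1 : x = p
    · subst h1; simp [h]
    by_cases h2 : x = q
    · subst h2; simp [h]
    rw [Equiv.swap_apply_of_ne_of_ne h1 h2]⟩

theorem mem_of_swaps [Fintype P] (a : Finset P) (H : Subgroup G)
    (hs : ∀ p q (h : v p = v q), p ∉ a → q ∉ a → conjSub (L (swA v p q h)) H = H) :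
    H ∈ FA v L a := by
  have key : ∀ (k : ℕ) (σ : permA v), (∀ p ∈ a, σ.1 p = p) → σ.1.support.card = k →
      conjSub (L σ) H = H := by
    intro k
    induction k using Nat.strong_induction_on with
    | _ k ih =>
      intro σ hσ hk
      by_cases h1 : ∀ p, σ.1 p = p
      · have : σ = 1 := by ext p; simp [h1 p]
        rw [this, map_one, conjSub_one]
      · push Not at h1
        obtain ⟨p, hp⟩ := h1
        have hpa : p ∉ a := fun h => hp (hσ p h)
        have hqa : σ.1 p ∉ a := fun h => hp (σ.1.injective (hσ _ h))
        have hv : v p = v (σ.1 p) := (σ.2 p).symm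
        have hlt : (swA v p (σ.1 p) hv * σ).1.support.card < k := by
          rw [← hk]
          exact Equiv.Perm.card_support_swap_mul hp
        have h2 := ih _ hlt (swA v p (σ.1 p) hv * σ) (by
          intro x hx
          have hxs := hσ x hx
          change Equiv.swap p (σ.1 p) (σ.1 x) = x
          rw [hxs, Equiv.swap_apply_of_ne_of_ne]
          · rintro rfl; exact hpa hx
          · rintro h; rw [h] at hx; exact hqa hx) rfl
        have h3 := conjSub_inv_fix (hs p (σ.1 p) hv hpa hqa)
        have h4 : σ = (swA v p (σ.1 p) hv)⁻¹ * (swA v p (σ.1 p) hv * σ) := by simp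
        rw [h4, map_mul, conjSub_mul, h2, map_inv, h3]
  exact fun σ hσ => key _ σ hσ rfl

theorem FA_inter [Fintype P] [DecidableEq V] {r : ℕ} (a b : Finset P)
    (ha : a.card ≤ r) (hb : b.card ≤ r)
    (hbig : ∀ p : P, 2 * r < (Finset.univ.filter fun q => v q = v p).card)
    {H : Subgroup G} (h1 : H ∈ FA v L a) (h2 : H ∈ FA v L b) : H ∈ FA v L (a ∩ b) := by
  have swa : ∀ (c : Finset P), H ∈ FA v L c → ∀ p q (h : v p = v q), p ∉ c → q ∉ c →
      conjSub (L (swA v p q h)) H = H := by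
    intro c hc p q h hp hq
    refine hc _ fun x hx => ?_
    change Equiv.swap p q x = x
    rw [Equiv.swap_apply_of_ne_of_ne]
    · rintro rfl; exact hp hx
    · rintro rfl; exact hq hx
  have aux : ∀ (c d : Finset P), c.card ≤ r → d.card ≤ r → H ∈ FA v L c → H ∈ FA v L d →
      ∀ p q (h : v p = v q), p ∉ c → q ∉ d → conjSub (L (swA v p q h)) H = H := by
    intro c d hc hd h1 h2 p q h hp hq
    by_cases hqc : q ∉ c
    · exact swa c h1 p q h hp hqc
    by_cases hpd : p ∉ d
    · exact swa d h2 p q h hpd hq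
    push Not at hqc hpd
    obtain ⟨s, hs, hs'⟩ : ∃ s ∈ (Finset.univ.filter fun q => v q = v p), s ∉ c ∪ d := by
      apply Finset.exists_mem_notMem_of_card_lt_card
      have := Finset.card_union_le c d
      have := hbig p
      omega
    simp only [Finset.mem_filter, Finset.mem_univ, true_and] at hs
    rw [Finset.mem_union, not_or] at hs'
    have e1 := swa c h1 p s hs.symm hp hs'.1
    have e2 := swa d h2 s q (hs.trans h) hs'.2 hq
    have e3 : swA v p q h = swA v p s hs.symm * swA v s q (hs.trans h) * swA v p s hs.symm := by
      apply Subtype.ext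
      change Equiv.swap p q = Equiv.swap p s * Equiv.swap s q * Equiv.swap p s
      have hsp : s ≠ p := by rintro rfl; exact hs'.2 hpd
      have hsq : s ≠ q := by rintro rfl; exact hs'.1 hqc
      have hpq : p ≠ q := by rintro rfl; exact hp hqc
      ext x
      simp only [Equiv.Perm.mul_apply, Equiv.swap_apply_def]
      split_ifs <;> simp_all
    rw [e3, map_mul, map_mul, conjSub_mul, conjSub_mul, e1, e2, e1]
  refine mem_of_swaps v L _ H fun p q h hp hq => ?_
  rw [Finset.mem_inter, not_and_or] at hp hq
  rcases hp with hp | hp <;> rcases hq with hq | hq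
  · exact swa a h1 p q h hp hq
  · exact aux a b ha hb h1 h2 p q h hp hq
  · exact aux b a hb ha h2 h1 p q h hp hq
  · exact swa b h2 p q h hp hq

/-- Subgroups normalized with fewer than `r` fixed points. -/
def MA (r : ℕ) : Set (Subgroup G) := { H | ∃ a : Finset P, a.card < r ∧ H ∈ FA v L a }

/-- Subgroups normalized with exactly `r` fixed points, among which `p, q`. -/
def SA (r : ℕ) (p q : P) : Set (Subgroup G) :=
  { H | H ∉ MA v L r ∧ ∃ a : Finset P, a.card ≤ r ∧ p ∈ a ∧ q ∈ a ∧ H ∈ FA v L a }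

theorem measurableSet_MA [Fintype P] [Countable G] (r : ℕ) : MeasurableSet (MA v L r) := by
  have : MA v L r = ⋃ (a : Finset P) (_ : a.card < r), FA v L a := by
    ext H; simp [MA]
  rw [this]
  exact MeasurableSet.iUnion fun a => MeasurableSet.iUnion fun _ => measurableSet_FA v L a

theorem measurableSet_SA [Fintype P] [Countable G] (r : ℕ) (p q : P) :
    MeasurableSet (SA v L r p q) := by
  have : SA v L r p q = (MA v L r)ᶜ ∩
      ⋃ (a : Finset P) (_ : a.card ≤ r ∧ p ∈ a ∧ q ∈ a), FA v L a := by
    ext H; simp [SA, and_assoc]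
  rw [this]
  exact (measurableSet_MA v L r).compl.inter
    (MeasurableSet.iUnion fun a => MeasurableSet.iUnion fun _ => measurableSet_FA v L a)

theorem MA_conj_of (r : ℕ) (τ : permA v) (H : Subgroup G) (h : H ∈ MA v L r) :
    conjSub (L τ) H ∈ MA v L r := by
  obtain ⟨a, ha, h⟩ := h
  exact ⟨a.image τ.1, Finset.card_image_le.trans_lt ha, (FA_conj v L a τ H).2 h⟩

theorem MA_conj (r : ℕ) (τ : permA v) (H : Subgroup G) :
    conjSub (L τ) H ∈ MA v L r ↔ H ∈ MA v L r := by
  refine ⟨fun h => ?_, MA_conj_of v L r τ H⟩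
  have := MA_conj_of v L r τ⁻¹ _ h
  rwa [← conjSub_mul, ← map_mul, inv_mul_cancel, map_one, conjSub_one] at this

theorem SA_conj_of (r : ℕ) (p q : P) (τ : permA v) (H : Subgroup G) (h : H ∈ SA v L r p q) :
    conjSub (L τ) H ∈ SA v L r (τ.1 p) (τ.1 q) := by
  obtain ⟨h0, a, ha, hp, hq, h⟩ := h
  exact ⟨by rwa [MA_conj], a.image τ.1, Finset.card_image_le.trans ha,
    Finset.mem_image_of_mem _ hp, Finset.mem_image_of_mem _ hq, (FA_conj v L a τ H).2 h⟩

theorem SA_preimage (r : ℕ) (p q : P) (τ : permA v) :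
    conjSub (L τ) ⁻¹' (SA v L r (τ.1 p) (τ.1 q)) = SA v L r p q := by
  ext H
  refine ⟨fun h => ?_, SA_conj_of v L r p q τ H⟩
  have := SA_conj_of v L r _ _ τ⁻¹ _ h
  rw [← conjSub_mul, ← map_mul, inv_mul_cancel, map_one, conjSub_one] at this
  simpa using this

theorem core_bound [Fintype P] [DecidableEq V] [Countable G]
    (φ : Measure (Subgroup G)) (hφ : IsIRS G φ) (r K C : ℕ)
    (close : P → P → Prop) [DecidableRel close] (hclose : ∀ p q, close p q → v p = v q)
    (hC : ∀ p, (Finset.univ.filter fun q => close p q).card ≤ C)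
    (hbig : ∀ p : P, 2 * r < (Finset.univ.filter fun q => v q = v p).card)
    (hK : ∀ p : P, K < (Finset.univ.filter fun q => v q = v p).card) :
    (K : ℝ≥0∞) * φ {H | ∃ a : Finset P, a.card ≤ r ∧ H ∈ FA v L a ∧
        ∃ p ∈ a, ∃ q ∈ a, p ≠ q ∧ close p q}
      ≤ K * φ (MA v L r) + C * (r * r : ℕ) := by
  classical
  have := hφ.1
  -- total mass
  have htot : ∑ pq : P × P, φ (SA v L r pq.1 pq.2) ≤ (r * r : ℕ) := by
    have h1 : ∀ pq : P × P, φ (SA v L r pq.1 pq.2) =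
        ∫⁻ H, (SA v L r pq.1 pq.2).indicator 1 H ∂φ := fun pq => by
      rw [lintegral_indicator_one (measurableSet_SA v L r pq.1 pq.2)]
    simp_rw [h1]
    rw [← lintegral_finsetSum _ fun pq _ =>
      (measurable_one.indicator (measurableSet_SA v L r pq.1 pq.2))]
    calc _ ≤ ∫⁻ _, ((r * r : ℕ) : ℝ≥0∞) ∂φ := by
          refine lintegral_mono fun H => ?_
          simp only [Set.indicator_apply, Pi.one_apply, Finset.sum_boole]
          norm_cast
          by_cases hH : ∃ pq : P × P, H ∈ SA v L r pq.1 pq.2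
          · obtain ⟨pq, h0, a, ha, -, -, hFa⟩ := hH
            refine (Finset.card_le_card (t := a ×ˢ a) ?_).trans ?_
            · intro xy hxy
              simp only [Finset.mem_filter, Finset.mem_univ, true_and] at hxy
              obtain ⟨-, b, hb, hxb, hyb, hFb⟩ := hxy
              have hi := FA_inter v L a b ha hb hbig hFa hFb
              have hc : r ≤ (a ∩ b).card := by
                by_contra hcon
                exact h0 ⟨_, not_le.1 hcon, hi⟩
              have hab : a ∩ b = b :=
                Finset.eq_of_subset_of_card_le Finset.inter_subset_right (hb.trans hc)
              have hba : b ⊆ a := by rw [← hab]; exact Finset.inter_subset_left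
              exact Finset.mem_product.2 ⟨hba hxb, hba hyb⟩
            · rw [Finset.card_product]
              exact Nat.mul_le_mul ha ha
          · push Not at hH
            rw [Finset.filter_false_of_mem (fun x _ => hH x)]
            simp
      _ = _ := by simp
  have hpq : ∀ p q, close p q → p ≠ q →
      (K : ℝ≥0∞) * φ (SA v L r p q) ≤ ∑ q', φ (SA v L r p q') := by
    intro p q hcl hne
    set T := (Finset.univ.filter fun q' => v q' = v p).erase p with hT
    have hTc : K ≤ T.card := by
      have := hK p
      rw [hT, Finset.card_erase_of_mem (by simp)]
      omega
    calc (K : ℝ≥0∞) * φ (SA v L r p q) ≤ T.card * φ (SA v L r p q) := by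
          gcongr
      _ = ∑ q' ∈ T, φ (SA v L r p q') := by
          rw [← nsmul_eq_mul, ← Finset.sum_const]
          refine Finset.sum_congr rfl fun q' hq' => ?_
          rw [hT, Finset.mem_erase, Finset.mem_filter] at hq'
          have hv : v q = v q' := (hclose p q hcl).symm.trans hq'.2.2.symm
          have h1 := SA_preimage v L r p q (swA v q q' hv)
          have e1 : (swA v q q' hv).1 p = p := Equiv.swap_apply_of_ne_of_ne hne hq'.1.symm
          have e2 : (swA v q q' hv).1 q = q' := Equiv.swap_apply_left q q'
          rw [e1, e2] at h1
          rw [← h1]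
          exact hφ.2 _ _ (measurableSet_SA v L r p q')
      _ ≤ _ := Finset.sum_le_sum_of_subset (Finset.subset_univ _)
  have hsub : {H | ∃ a : Finset P, a.card ≤ r ∧ H ∈ FA v L a ∧
        ∃ p ∈ a, ∃ q ∈ a, p ≠ q ∧ close p q} ⊆ MA v L r ∪
      ⋃ p ∈ (Finset.univ : Finset P), ⋃ q ∈ Finset.univ.filter fun q => close p q ∧ p ≠ q,
        SA v L r p q := by
    rintro H ⟨a, ha, hF, p, hp, q, hq, hne, hcl⟩
    by_cases hM : H ∈ MA v L r
    · exact Or.inl hM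
    · right
      simp only [Set.mem_iUnion]
      exact ⟨p, Finset.mem_univ _, q, by simp [hcl, hne], hM, a, ha, hp, hq, hF⟩
  have hunion : φ (⋃ p ∈ (Finset.univ : Finset P),
      ⋃ q ∈ Finset.univ.filter fun q => close p q ∧ p ≠ q, SA v L r p q) ≤
      ∑ p, ∑ q ∈ Finset.univ.filter fun q => close p q ∧ p ≠ q, φ (SA v L r p q) :=
    (measure_biUnion_finset_le _ _).trans
      (Finset.sum_le_sum fun p _ => measure_biUnion_finset_le _ _)
  calc _ ≤ (K : ℝ≥0∞) * (φ (MA v L r) +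
        ∑ p, ∑ q ∈ Finset.univ.filter fun q => close p q ∧ p ≠ q, φ (SA v L r p q)) := by
        gcongr
        exact (measure_mono hsub).trans ((measure_union_le _ _).trans (by gcongr))
    _ = K * φ (MA v L r) +
        ∑ p, ∑ q ∈ Finset.univ.filter fun q => close p q ∧ p ≠ q,
          (K : ℝ≥0∞) * φ (SA v L r p q) := by
        rw [mul_add, Finset.mul_sum]
        simp_rw [Finset.mul_sum]
    _ ≤ K * φ (MA v L r) + ∑ p, (C : ℝ≥0∞) * ∑ q', φ (SA v L r p q') := by
        gcongr with p _
        calc _ ≤ ∑ q ∈ Finset.univ.filter fun q => close p q ∧ p ≠ q,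
              ∑ q', φ (SA v L r p q') := by
              refine Finset.sum_le_sum fun q hq => ?_
              simp only [Finset.mem_filter, Finset.mem_univ, true_and] at hq
              exact hpq p q hq.1 hq.2
          _ ≤ _ := by
              rw [Finset.sum_const, nsmul_eq_mul]
              gcongr
              refine le_trans (Finset.card_le_card ?_) (hC p)
              intro q hq
              simp only [Finset.mem_filter, Finset.mem_univ, true_and] at hq ⊢
              exact hq.1
    _ = K * φ (MA v L r) + C * ∑ pq : P × P, φ (SA v L r pq.1 pq.2) := by
        rw [← Finset.mul_sum, Fintype.sum_prod_type]
    _ ≤ _ := by gcongr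

end Core

/-! ### The finite levels of a Bratteli diagram -/

namespace BratteliDiagram

variable (B : BratteliDiagram)

theorem exists_path_of_base (base : ∀ i, B.E i) (m : ℕ)
    (hb : ∀ i, i < m → B.rng i (base i) = B.src (i + 1) (base (i + 1))) :
    ∃ y : B.Path, ∀ i, i ≤ m → y.1 i = base i := by
  classical
  let y : ∀ i, B.E i := fun i => Nat.rec (motive := fun i => B.E i) (base 0)
    (fun i yi => if i + 1 ≤ m then base (i + 1) else (B.src_surj (i + 1) (B.rng i yi)).choose) i
  have hy : ∀ i, y (i + 1) = if i + 1 ≤ m then base (i + 1) else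
      (B.src_surj (i + 1) (B.rng i (y i))).choose := fun i => rfl
  have h1 : ∀ i, i ≤ m → y i = base i := by
    intro i hi
    cases i with
    | zero => rfl
    | succ i => rw [hy, if_pos hi]
  refine ⟨⟨y, fun i => ?_⟩, h1⟩
  by_cases hi : i + 1 ≤ m
  · rw [h1 i (by omega), h1 (i + 1) hi]
    exact hb i hi
  · rw [hy, if_neg hi]
    exact (B.src_surj (i + 1) (B.rng i (y i))).choose_spec.symm

instance : Nonempty B.Path := by
  obtain ⟨y, -⟩ := B.exists_path_of_base (fun i => (B.nonemptyE i).some) 0 (by simp)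
  exact ⟨y⟩

/-- The vertex at level `m` of a path. -/
def vert (m : ℕ) (x : B.Path) : B.V m := B.src m (x.1 m)

theorem exists_path_extend (x : B.Path) (m : ℕ) (e : B.E m) (he : B.src m e = B.vert m x) :
    ∃ y : B.Path, (∀ i, i < m → y.1 i = x.1 i) ∧ y.1 m = e := by
  obtain ⟨y, hy⟩ := B.exists_path_of_base (Function.update x.1 m e) m (by
    intro i hi
    rw [Function.update_of_ne (by omega)]
    by_cases h : i + 1 = m
    · subst h
      rw [Function.update_self, he]
      exact x.2 i
    · rw [Function.update_of_ne h]
      exact x.2 i)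
  refine ⟨y, fun i hi => ?_, ?_⟩
  · rw [hy i hi.le, Function.update_of_ne (by omega)]
  · rw [hy m le_rfl, Function.update_self]

theorem vert_surj (m : ℕ) (w : B.V m) : ∃ x : B.Path, B.vert m x = w := by
  induction m with
  | zero =>
    have := B.subsingleton_root
    exact ⟨Classical.arbitrary _, Subsingleton.elim _ _⟩
  | succ m ih =>
    obtain ⟨e, rfl⟩ := B.rng_surj m w
    obtain ⟨x, hx⟩ := ih (B.src m e)
    obtain ⟨y, -, hy⟩ := B.exists_path_extend x m e hx.symm
    exact ⟨y, by rw [vert, ← y.2 m, hy]⟩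

theorem vert_congr {m : ℕ} {x y : B.Path} (h : ∀ i, i < m → x.1 i = y.1 i) :
    B.vert m x = B.vert m y := by
  cases m with
  | zero =>
    have := B.subsingleton_root
    exact Subsingleton.elim _ _
  | succ m => rw [vert, vert, ← x.2 m, ← y.2 m, h m (by omega)]

/-- Truncation to the first `m` edges. -/
def trunc (m : ℕ) (x : B.Path) : ∀ i : Fin m, B.E i := fun i => x.1 i

/-- Paths of length `m` from the root. -/
def Pre (m : ℕ) : Type := Set.range (B.trunc m)

instance (m : ℕ) : Finite (B.Pre m) := by
  have : ∀ i, Finite (B.E i) := fun i => @Finite.of_fintype _ (B.fintypeE i)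
  unfold Pre
  infer_instance

instance (m : ℕ) : Fintype (B.Pre m) := Fintype.ofFinite _

instance (m : ℕ) : DecidableEq (B.Pre m) := Classical.decEq _
instance (m : ℕ) : DecidableEq (B.V m) := Classical.decEq _

/-- Truncation. -/
def tr (m : ℕ) (x : B.Path) : B.Pre m := ⟨B.trunc m x, x, rfl⟩

/-- A representative. -/
def rep {m : ℕ} (p : B.Pre m) : B.Path := p.2.choose

theorem tr_rep {m : ℕ} (p : B.Pre m) : B.tr m (B.rep p) = p := Subtype.ext p.2.choose_spec

theorem tr_eq_iff {m : ℕ} {x y : B.Path} : B.tr m x = B.tr m y ↔ ∀ i, i < m → x.1 i = y.1 i := by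
  constructor
  · intro h i hi
    exact congrFun (congrArg Subtype.val h) ⟨i, hi⟩
  · intro h
    exact Subtype.ext (funext fun i => h i i.2)

theorem rep_tr (m : ℕ) (x : B.Path) : ∀ i, i < m → (B.rep (B.tr m x)).1 i = x.1 i :=
  B.tr_eq_iff.1 (B.tr_rep _)

/-- The end vertex of a finite path. -/
def vP (m : ℕ) (p : B.Pre m) : B.V m := B.vert m (B.rep p)

theorem vP_tr (m : ℕ) (x : B.Path) : B.vP m (B.tr m x) = B.vert m x :=
  B.vert_congr (B.rep_tr m x)

/-- First `m` edges of `x`, then `y`. -/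
def splice (m : ℕ) (x y : B.Path) (h : B.vert m x = B.vert m y) : B.Path :=
  ⟨fun i => if i < m then x.1 i else y.1 i, by
    intro i
    by_cases h1 : i + 1 < m
    · simp only [h1, if_true, show i < m by omega]
      exact x.2 i
    · by_cases h2 : i < m
      · have : i + 1 = m := by omega
        subst this
        simp only [h2, if_true, lt_irrefl, if_false]
        rw [x.2 i]
        exact h
      · simp only [h1, h2, if_false]
        exact y.2 i⟩

theorem splice_lt {m : ℕ} {x y : B.Path} (h) {i : ℕ} (hi : i < m) :
    (B.splice m x y h).1 i = x.1 i := if_pos hi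

theorem splice_ge {m : ℕ} {x y : B.Path} (h) {i : ℕ} (hi : m ≤ i) :
    (B.splice m x y h).1 i = y.1 i := if_neg (by omega)

theorem path_ext {m : ℕ} {x y : B.Path} (h1 : ∀ i, i < m → x.1 i = y.1 i)
    (h2 : ∀ i, m ≤ i → x.1 i = y.1 i) : x = y :=
  Subtype.ext (funext fun i => (lt_or_ge i m).elim (h1 i) (h2 i))

/-- The action on a path of a permutation of finite paths. -/
def act (m : ℕ) (σ : permA (B.vP m)) (x : B.Path) : B.Path :=
  B.splice m (B.rep (σ.1 (B.tr m x))) x ((σ.2 _).trans (B.vP_tr m x))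

theorem tr_act (m : ℕ) (σ : permA (B.vP m)) (x : B.Path) :
    B.tr m (B.act m σ x) = σ.1 (B.tr m x) := by
  rw [← B.tr_rep (σ.1 (B.tr m x)), tr_eq_iff]
  exact fun i hi => B.splice_lt _ hi

theorem act_ge {m : ℕ} (σ : permA (B.vP m)) (x : B.Path) {i : ℕ} (hi : m ≤ i) :
    (B.act m σ x).1 i = x.1 i := B.splice_ge _ hi

theorem act_ext {m : ℕ} {x y : B.Path} (h1 : B.tr m x = B.tr m y)
    (h2 : ∀ i, m ≤ i → x.1 i = y.1 i) : x = y := B.path_ext (B.tr_eq_iff.1 h1) h2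

theorem act_mul (m : ℕ) (σ τ : permA (B.vP m)) (x : B.Path) :
    B.act m (σ * τ) x = B.act m σ (B.act m τ x) := by
  apply B.act_ext (m := m)
  · simp [tr_act]
  · intro i hi
    rw [B.act_ge _ _ hi, B.act_ge _ _ hi, B.act_ge _ _ hi]

theorem act_one (m : ℕ) (x : B.Path) : B.act m 1 x = x := by
  apply B.act_ext (m := m)
  · simp [tr_act]
  · intro i hi
    rw [B.act_ge _ _ hi]

/-- The permutation of the path space. -/
def actPerm (m : ℕ) : permA (B.vP m) →* Equiv.Perm B.Path where
  toFun σ := ⟨B.act m σ, B.act m σ⁻¹, fun x => by rw [← act_mul, inv_mul_cancel, act_one],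
    fun x => by rw [← act_mul, mul_inv_cancel, act_one]⟩
  map_one' := Equiv.ext fun x => B.act_one m x
  map_mul' σ τ := Equiv.ext fun x => B.act_mul m σ τ x

theorem actPerm_apply (m : ℕ) (σ : permA (B.vP m)) (x : B.Path) :
    B.actPerm m σ x = B.act m σ x := rfl

theorem actPerm_isLevel (m : ℕ) (σ : permA (B.vP m)) : B.IsLevel m (B.actPerm m σ) := by
  refine ⟨fun x i hi => B.act_ge _ _ hi, fun x y h => ?_⟩
  rw [← tr_eq_iff] at h ⊢
  rw [actPerm_apply, actPerm_apply, tr_act, tr_act, h]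

theorem actPerm_mem (m : ℕ) (σ : permA (B.vP m)) : B.actPerm m σ ∈ B.level m :=
  ⟨B.actPerm_isLevel m σ, by rw [← map_inv]; exact B.actPerm_isLevel m σ⁻¹⟩

/-- The embedding of finite permutations in the full group. -/
def LL (m : ℕ) : permA (B.vP m) →* ↥B.fullGroup :=
  (B.actPerm m).codRestrict B.fullGroup fun σ => ⟨m, B.actPerm_mem m σ⟩

theorem LL_smul (m : ℕ) (σ : permA (B.vP m)) (x : B.Path) : B.LL m σ • x = B.act m σ x := rfl

theorem LL_mem (m : ℕ) (σ : permA (B.vP m)) : B.LL m σ ∈ B.levelIn m := B.actPerm_mem m σ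

theorem LL_surj (m : ℕ) (g : ↥B.fullGroup) (hg : g ∈ B.levelIn m) : ∃ σ, B.LL m σ = g := by
  have hg' : B.IsLevel m g.1 ∧ B.IsLevel m g.1⁻¹ := hg
  have key : ∀ k : Equiv.Perm B.Path, B.IsLevel m k → ∀ x,
      B.tr m (k (B.rep (B.tr m x))) = B.tr m (k x) := fun k hk x =>
    B.tr_eq_iff.2 (hk.2 _ _ (B.rep_tr m x))
  let σ : Equiv.Perm (B.Pre m) :=
    ⟨fun p => B.tr m (g.1 (B.rep p)), fun p => B.tr m (g.1⁻¹ (B.rep p)),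
      fun p => by
        change B.tr m (g.1⁻¹ (B.rep (B.tr m (g.1 (B.rep p))))) = p
        rw [key _ hg'.2, ← Equiv.Perm.mul_apply, inv_mul_cancel, Equiv.Perm.one_apply, tr_rep],
      fun p => by
        change B.tr m (g.1 (B.rep (B.tr m (g.1⁻¹ (B.rep p))))) = p
        rw [key _ hg'.1, ← Equiv.Perm.mul_apply, mul_inv_cancel, Equiv.Perm.one_apply, tr_rep]⟩
  refine ⟨⟨σ, fun p => ?_⟩, ?_⟩
  · change B.vP m (B.tr m (g.1 (B.rep p))) = B.vP m p
    rw [vP_tr, vert, hg'.1.1 _ m le_rfl]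
    rfl
  · apply Subtype.ext
    apply Equiv.ext
    intro x
    change B.act m _ x = g.1 x
    apply B.act_ext (m := m)
    · rw [tr_act]
      exact key _ hg'.1 x
    · intro i hi
      rw [B.act_ge _ _ hi, hg'.1.1 x i hi]

instance : Countable ↥B.fullGroup := by
  have h : Function.Surjective (fun s : Σ m, permA (B.vP m) => B.LL s.1 s.2) := by
    intro g
    obtain ⟨m, hm⟩ := g.2
    obtain ⟨σ, hσ⟩ := B.LL_surj m g hm
    exact ⟨⟨m, σ⟩, hσ⟩
  have : ∀ m, Countable (permA (B.vP m)) := fun m => inferInstance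
  exact h.countable

theorem mem_Gcirc {A : Set B.Path} {g : ↥B.fullGroup} : g ∈ B.Gcirc A ↔ ∀ x ∈ A, g • x = x := by
  simp [Gcirc, Subgroup.mem_iInf]

/-- Subgroups normalized by `G°_m(A)`. -/
def FN (m : ℕ) (A : Set B.Path) : Set (Subgroup ↥B.fullGroup) :=
  { H | ∀ g ∈ B.GcircN m A, conjSub g H = H }

theorem mem_FA_iff (m : ℕ) (A : Set B.Path) (a : Finset (B.Pre m)) (h : (a : Set _) = B.tr m '' A)
    (H : Subgroup ↥B.fullGroup) : H ∈ FA (B.vP m) (B.LL m) a ↔ H ∈ B.FN m A := by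
  have key : ∀ σ : permA (B.vP m), (∀ p ∈ a, σ.1 p = p) ↔ B.LL m σ ∈ B.Gcirc A := by
    intro σ
    rw [mem_Gcirc]
    constructor
    · intro hσ x hx
      rw [LL_smul]
      apply B.act_ext (m := m)
      · rw [tr_act]
        exact hσ _ (by rw [← Finset.mem_coe, h]; exact ⟨x, hx, rfl⟩)
      · exact fun i hi => B.act_ge _ _ hi
    · intro hσ p hp
      rw [← Finset.mem_coe, h] at hp
      obtain ⟨x, hx, rfl⟩ := hp
      rw [← tr_act, ← LL_smul, hσ x hx]
  constructor
  · rintro hH g ⟨hg1, hg2⟩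
    obtain ⟨σ, rfl⟩ := B.LL_surj m g hg1
    exact hH σ ((key σ).2 hg2)
  · intro hH σ hσ
    exact hH _ ⟨B.LL_mem m σ, (key σ).1 hσ⟩

theorem FN_anti {m m' : ℕ} (h : m ≤ m') (A : Set B.Path) : B.FN m' A ⊆ B.FN m A :=
  fun _ hH g hg => hH g ⟨B.level_mono h hg.1, hg.2⟩

theorem mem_FF_iff (A : Set B.Path) (H : Subgroup ↥B.fullGroup) :
    H ∈ B.FF A ↔ ∀ m, H ∈ B.FN m A := by
  constructor
  · exact fun h m g hg => h g hg.2
  · intro h g hg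
    obtain ⟨m, hm⟩ := g.2
    exact h m g ⟨hm, hg⟩

theorem mem_MA_iff (m r : ℕ) (H : Subgroup ↥B.fullGroup) :
    H ∈ MA (B.vP m) (B.LL m) r ↔ ∃ A : Finset B.Path, A.card < r ∧ H ∈ B.FN m A := by
  classical
  constructor
  · rintro ⟨a, ha, hH⟩
    refine ⟨a.image B.rep, Finset.card_image_le.trans_lt ha, ?_⟩
    rw [← B.mem_FA_iff m _ a ?_]
    · exact hH
    · ext p
      simp [tr_rep]
  · rintro ⟨A, hA, hH⟩
    refine ⟨A.image (B.tr m), Finset.card_image_le.trans_lt hA, ?_⟩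
    rw [B.mem_FA_iff m A _ (by simp)]
    exact hH

theorem MA_antitone (r : ℕ) : Antitone fun m => MA (B.vP m) (B.LL m) r := by
  intro m m' h H hH
  change H ∈ MA _ _ _ at hH
  change H ∈ MA _ _ _
  rw [mem_MA_iff] at hH ⊢
  obtain ⟨A, hA, hH⟩ := hH
  exact ⟨A, hA, B.FN_anti h _ hH⟩

instance (i : ℕ) : DiscreteTopology (B.E i) := ⟨rfl⟩

instance : CompactSpace B.Path := by
  have : ∀ i, Finite (B.E i) := fun i => @Finite.of_fintype _ (B.fintypeE i)
  have hc : IsClosed {x : ∀ i, B.E i | ∀ i, B.rng i (x i) = B.src (i + 1) (x (i + 1))} := by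
    have : {x : ∀ i, B.E i | ∀ i, B.rng i (x i) = B.src (i + 1) (x (i + 1))} =
        ⋂ i, (fun x : ∀ i, B.E i => (x i, x (i + 1))) ⁻¹'
          {q | B.rng i q.1 = B.src (i + 1) q.2} := by
      ext x; simp
    rw [this]
    exact isClosed_iInter fun i => (isClosed_discrete _).preimage (by fun_prop)
  exact isCompact_iff_compactSpace.1 hc.isCompact

theorem isClosed_tr {ι : Type} [Finite ι] (m : ℕ) (S : Set (ι → B.Pre m)) :
    IsClosed {t : ι → B.Path | (fun i => B.tr m (t i)) ∈ S} := by
  have hc : Continuous fun t : ι → B.Path => fun (i : ι) (j : Fin m) => (t i).1 j.1 := by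
    refine continuous_pi fun i => continuous_pi fun j => ?_
    have h1 : Continuous fun x : B.Path => x.1 j.1 :=
      (continuous_apply j.1).comp continuous_subtype_val
    exact h1.comp (continuous_apply i)
  have : {t : ι → B.Path | (fun i => B.tr m (t i)) ∈ S} =
      (fun t : ι → B.Path => fun (i : ι) (j : Fin m) => (t i).1 j.1) ⁻¹'
        ((fun s : ι → B.Pre m => fun (i : ι) (j : Fin m) => (s i).1 j) '' S) := by
    ext t
    constructor
    · exact fun h => ⟨_, h, rfl⟩
    · rintro ⟨s, hs, h⟩
      have : s = fun i => B.tr m (t i) := by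
        funext i
        exact Subtype.ext (congrFun h i)
      rw [this] at hs
      exact hs
  rw [this]
  exact (isClosed_discrete _).preimage hc

theorem iInter_MA (r : ℕ) (hr : 1 ≤ r) :
    (⋂ m, MA (B.vP m) (B.LL m) r) ⊆
      ⋃ (xb : Set B.Path) (_ : xb.Finite ∧ xb.ncard ≤ r - 1), B.FF xb := by
  classical
  intro H hH
  rw [Set.mem_iInter] at hH
  have hne : (⋂ m, {t : Fin (r - 1) → B.Path | H ∈ B.FN m (Set.range t)}).Nonempty := by
    have hcl : ∀ m, IsClosed {t : Fin (r - 1) → B.Path | H ∈ B.FN m (Set.range t)} := by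
      intro m
      have : {t : Fin (r - 1) → B.Path | H ∈ B.FN m (Set.range t)} =
          {t | (fun i => B.tr m (t i)) ∈
            {s : Fin (r - 1) → B.Pre m | H ∈ FA (B.vP m) (B.LL m) (Finset.univ.image s)}} := by
        ext t
        refine (B.mem_FA_iff m (Set.range t) _ ?_ H).symm
        ext p
        simp
      rw [this]
      exact B.isClosed_tr m _
    apply IsCompact.nonempty_iInter_of_sequence_nonempty_isCompact_isClosed
    · exact fun m t ht => B.FN_anti (Nat.le_succ m) _ ht
    · intro m
      obtain ⟨A, hA, hH⟩ := (B.mem_MA_iff m r H).1 (hH m)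
      refine ⟨fun i => A.toList.getD i (Classical.arbitrary _), ?_⟩
      refine fun g hg => hH g ⟨hg.1, ?_⟩
      have hg2 := B.mem_Gcirc.1 hg.2
      refine B.mem_Gcirc.2 fun x hx => hg2 x ?_
      have hx' : x ∈ A.toList := by simpa using hx
      obtain ⟨i, hi, rfl⟩ := List.getElem_of_mem hx'
      refine ⟨⟨i, by rw [Finset.length_toList] at hi; omega⟩, ?_⟩
      exact List.getD_eq_getElem _ _ hi
    · exact (hcl 0).isCompact
    · exact hcl
  obtain ⟨t, ht⟩ := hne
  rw [Set.mem_iInter] at ht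
  simp only [Set.mem_iUnion]
  refine ⟨Set.range t, ⟨Set.finite_range t, ?_⟩, (B.mem_FF_iff _ _).2 ht⟩
  rw [← Set.image_univ]
  refine (Set.ncard_image_le Set.finite_univ).trans ?_
  simp

/-! ### Growth -/

/-- number of paths from the root to `w` -/
def cnt (m : ℕ) (w : B.V m) : ℕ := (Finset.univ.filter fun q => B.vP m q = w).card

theorem cnt_pos (m : ℕ) (w : B.V m) : 1 ≤ B.cnt m w := by
  obtain ⟨x, hx⟩ := B.vert_surj m w
  refine Finset.card_pos.2 ⟨B.tr m x, ?_⟩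
  simp [vP_tr, hx]

theorem cnt_succ (m k : ℕ) (h : ∀ w, k ≤ B.cnt m w) (w : B.V (m + 1)) : k ≤ B.cnt (m + 1) w := by
  obtain ⟨e, rfl⟩ := B.rng_surj m w
  refine (h (B.src m e)).trans ?_
  have hex : ∀ p : B.Pre m, ∃ y : B.Path, B.vP m p = B.src m e →
      B.tr m y = p ∧ y.1 m = e := by
    intro p
    by_cases hp : B.vP m p = B.src m e
    · obtain ⟨y, hy1, hy2⟩ := B.exists_path_extend (B.rep p) m e hp.symm
      exact ⟨y, fun _ => ⟨by rw [← B.tr_rep p, tr_eq_iff]; exact hy1, hy2⟩⟩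
    · exact ⟨Classical.arbitrary _, fun h => absurd h hp⟩
  choose f hf using hex
  refine Finset.card_le_card_of_injOn (fun p => B.tr (m + 1) (f p)) ?_ ?_
  · intro p hp
    simp only [Finset.coe_filter, Finset.mem_univ, true_and] at hp ⊢
    have := hf p hp
    change B.vP (m + 1) _ = _
    rw [vP_tr, vert, ← (f p).2 m, this.2]
  · intro p hp q hq hpq
    simp only [Finset.coe_filter, Finset.mem_univ, true_and] at hp hq
    rw [← (hf p hp).1, ← (hf q hq).1, tr_eq_iff]
    exact fun i hi => B.tr_eq_iff.1 hpq i (by omega)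

theorem cnt_le {m m' : ℕ} (hm : m ≤ m') (k : ℕ) (h : ∀ w, k ≤ B.cnt m w) :
    ∀ w, k ≤ B.cnt m' w := by
  induction m', hm using Nat.le_induction with
  | base => exact h
  | succ m' _ ih => exact B.cnt_succ m' k ih

theorem exists_path_seg (n L : ℕ) (x : B.Path) (f : B.Seg n L)
    (hf : B.src n (f.1 ⟨0, by omega⟩) = B.vert n x) (k : ℕ) (hk : k < L + 1) :
    ∃ y : B.Path, (∀ i, i < n → y.1 i = x.1 i) ∧
      ∀ i (hi : i < k + 1), y.1 (n + i) = f.1 ⟨i, by omega⟩ := by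
  induction k with
  | zero =>
    obtain ⟨y, hy1, hy2⟩ := B.exists_path_extend x n _ hf
    refine ⟨y, hy1, fun i hi => ?_⟩
    obtain rfl : i = 0 := by omega
    exact hy2
  | succ k ih =>
    obtain ⟨z, hz1, hz2⟩ := ih (by omega)
    obtain ⟨y, hy1, hy2⟩ := B.exists_path_extend z (n + (k + 1)) (f.1 ⟨k + 1, hk⟩) (by
      rw [← f.2 k (by omega), ← hz2 k (by omega)]
      exact z.2 (n + k))
    refine ⟨y, fun i hi => ?_, fun i hi => ?_⟩
    · rw [hy1 i (by omega), hz1 i hi]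
    · by_cases h : i = k + 1
      · subst h
        exact hy2
      · rw [hy1 _ (by omega)]
        exact hz2 i (by omega)

theorem cnt_double (heven : B.IsEven) (n k : ℕ) (h : ∀ w, k ≤ B.cnt n w) :
    ∃ m, ∀ w, 2 * k ≤ B.cnt m w := by
  classical
  obtain ⟨L, hL⟩ := heven n
  refine ⟨n + L + 1, fun w => ?_⟩
  let u : B.V n := (B.nonemptyV n).some
  obtain ⟨h0, c, hc⟩ := hL u w
  have h2 : 2 ≤ B.numPaths n L u w := by omega
  set S := { f : B.Seg n L //
    B.src n (f.1 ⟨0, by omega⟩) = u ∧ B.rng (n + L) (f.1 ⟨L, by omega⟩) = w } with hS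
  have hcard : 2 ≤ Nat.card S := h2
  have hfin : Finite S := Nat.finite_of_card_ne_zero (by omega)
  have := Fintype.ofFinite S
  rw [Nat.card_eq_fintype_card] at hcard
  have hex : ∀ (p : B.Pre n) (s : S), ∃ y : B.Path, B.vP n p = u →
      B.tr n y = p ∧ ∀ i (hi : i < L + 1), y.1 (n + i) = s.1.1 ⟨i, hi⟩ := by
    intro p s
    by_cases hp : B.vP n p = u
    · obtain ⟨y, hy1, hy2⟩ := B.exists_path_seg n L (B.rep p) s.1 (s.2.1.trans hp.symm) L (by omega)
      exact ⟨y, fun _ => ⟨by rw [← B.tr_rep p, tr_eq_iff]; exact hy1, hy2⟩⟩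
    · exact ⟨Classical.arbitrary _, fun h => absurd h hp⟩
  choose f hf using hex
  calc 2 * k ≤ Fintype.card S * B.cnt n u := Nat.mul_le_mul hcard (h u)
    _ = ((Finset.univ : Finset S) ×ˢ (Finset.univ.filter fun q => B.vP n q = u)).card := by
        rw [Finset.card_product]; rfl
    _ ≤ _ := by
        refine Finset.card_le_card_of_injOn (fun sp => B.tr (n + L + 1) (f sp.2 sp.1)) ?_ ?_
        · rintro ⟨s, p⟩ hp
          simp only [Finset.coe_product, Finset.coe_univ, Finset.coe_filter, Finset.mem_univ,
            true_and, Set.mem_prod, Set.mem_univ] at hp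
          have hp : B.vP n p = u := hp
          simp only [Finset.coe_filter, Finset.mem_univ, true_and]
          change B.vP (n + L + 1) _ = _
          rw [vP_tr, vert, ← (f p s).2 (n + L), (hf p s hp).2 L (by omega)]
          exact s.2.2
        · rintro ⟨s, p⟩ hp ⟨s', p'⟩ hp' heq
          simp only [Finset.coe_product, Finset.coe_univ, Finset.coe_filter, Finset.mem_univ,
            true_and, Set.mem_prod, Set.mem_univ] at hp hp'
          have hp : B.vP n p = u := hp
          have hp' : B.vP n p' = u := hp'
          have heq := B.tr_eq_iff.1 heq
          have e1 : p = p' := by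
            rw [← (hf p s hp).1, ← (hf p' s' hp').1, tr_eq_iff]
            exact fun i hi => heq i (by omega)
          have e2 : s = s' := by
            apply Subtype.ext
            apply Subtype.ext
            funext i
            rw [← (hf p s hp).2 i i.2, ← (hf p' s' hp').2 i i.2]
            exact heq _ (by omega)
          rw [e1, e2]

theorem cnt_large (heven : B.IsEven) (k : ℕ) : ∃ m, ∀ m', m ≤ m' → ∀ w, k ≤ B.cnt m' w := by
  have : ∃ m, ∀ w, k ≤ B.cnt m w := by
    induction k with
    | zero => exact ⟨0, fun w => Nat.zero_le _⟩
    | succ k ih =>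
      obtain ⟨m, hm⟩ := ih
      rcases Nat.eq_zero_or_pos k with rfl | hk
      · exact ⟨0, B.cnt_pos 0⟩
      obtain ⟨m', hm'⟩ := B.cnt_double heven m k hm
      exact ⟨m', fun w => le_trans (by omega) (hm' w)⟩
  obtain ⟨m, hm⟩ := this
  exact ⟨m, fun m' h => B.cnt_le h k hm⟩

/-- Finite paths agreeing from level `n` on. -/
def closeP (n m : ℕ) (p q : B.Pre m) : Prop :=
  B.vP m p = B.vP m q ∧ ∀ i (hi : i < m), n ≤ i → p.1 ⟨i, hi⟩ = q.1 ⟨i, hi⟩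

theorem closeP_card (n m : ℕ) [DecidableRel (B.closeP n m)] (p : B.Pre m) :
    (Finset.univ.filter fun q => B.closeP n m p q).card ≤ Fintype.card (B.Pre n) := by
  refine Finset.card_le_card_of_injOn (fun q => B.tr n (B.rep q)) (by simp) ?_
  intro q hq q' hq' heq
  simp only [Finset.coe_filter, Finset.mem_univ, true_and] at hq hq'
  have hq : B.closeP n m p q := hq
  have hq' : B.closeP n m p q' := hq'
  have heq := B.tr_eq_iff.1 heq
  apply Subtype.ext
  funext i
  rcases lt_or_ge i.1 n with h | h
  · have h1 := congrFun (congrArg Subtype.val (B.tr_rep q)) i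
    have h2 := congrFun (congrArg Subtype.val (B.tr_rep q')) i
    rw [← h1, ← h2]
    exact heq i h
  · exact (hq.2 i i.2 h).symm.trans (hq'.2 i i.2 h)

/-- Subgroups in some `F(A)` with `A` of size `r` with two points agreeing from level `n` on. -/
def SN (r n : ℕ) : Set (Subgroup ↥B.fullGroup) :=
  { H | ∃ A : Finset B.Path, A.card ≤ r ∧ H ∈ B.FF A ∧ ∃ x ∈ A, ∃ y ∈ A, x ≠ y ∧
    ∀ i, n ≤ i → x.1 i = y.1 i }

theorem SN_null (heven : B.IsEven) (r : ℕ) (hr : 1 ≤ r)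
    (φ : Measure (Subgroup ↥B.fullGroup)) (hφ : IsIRS ↥B.fullGroup φ)
    (hsmall : φ (⋃ (xb : Set B.Path) (_ : xb.Finite ∧ xb.ncard ≤ r - 1), B.FF xb) = 0)
    (n : ℕ) : φ (B.SN r n) = 0 := by
  classical
  have := hφ.1
  set D : ℝ≥0∞ := (Fintype.card (B.Pre n) : ℝ≥0∞) * (r * r : ℕ) with hD
  have hDt : D ≠ ⊤ := ENNReal.mul_ne_top (ENNReal.natCast_ne_top _) (ENNReal.natCast_ne_top _)
  have hlim : Tendsto (fun m => φ (MA (B.vP m) (B.LL m) r)) atTop (nhds 0) := by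
    have h0 : φ (⋂ m, MA (B.vP m) (B.LL m) r) = 0 :=
      measure_mono_null (B.iInter_MA r hr) hsmall
    rw [← h0]
    exact tendsto_measure_iInter_atTop
      (fun m => (measurableSet_MA (B.vP m) (B.LL m) r).nullMeasurableSet) (B.MA_antitone r)
      ⟨0, measure_ne_top _ _⟩
  have hK : ∀ K : ℕ, (K : ℝ≥0∞) * φ (B.SN r n) ≤ D := by
    intro K
    obtain ⟨m0, hm0⟩ := B.cnt_large heven (max K (2 * r) + 1)
    have hlim2 : Tendsto (fun m => (K : ℝ≥0∞) * φ (MA (B.vP m) (B.LL m) r) + D) atTop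
        (nhds D) := by
      have := (ENNReal.Tendsto.const_mul hlim (Or.inr (ENNReal.natCast_ne_top K))).add_const D
      simpa using this
    refine ge_of_tendsto hlim2 ?_
    filter_upwards [eventually_ge_atTop m0, eventually_ge_atTop n] with m hm hmn
    refine le_trans ?_ (core_bound (B.vP m) (B.LL m) φ hφ r K (Fintype.card (B.Pre n))
      (B.closeP n m) (fun p q h => h.1) (B.closeP_card n m)
      (fun p => ?_) (fun p => ?_))
    · gcongr
      rintro H ⟨A, hA, hH, x, hx, y, hy, hne, hxy⟩
      refine ⟨A.image (B.tr m), Finset.card_image_le.trans hA, ?_, B.tr m x,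
        Finset.mem_image_of_mem _ hx, B.tr m y, Finset.mem_image_of_mem _ hy, ?_, ?_, ?_⟩
      · rw [B.mem_FA_iff m A _ (by simp)]
        exact (B.mem_FF_iff _ _).1 hH m
      · exact fun h => hne (B.act_ext h fun i hi => hxy i (hmn.trans hi))
      · rw [vP_tr, vP_tr, vert, vert, hxy m hmn]
      · exact fun i hi hni => hxy i hni
    · have := hm0 m hm (B.vP m p)
      unfold cnt at this
      omega
    · have := hm0 m hm (B.vP m p)
      unfold cnt at this
      omega
  by_contra hne
  obtain ⟨K, hK'⟩ := ENNReal.exists_nat_mul_gt hne hDt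
  exact absurd (hK K) (not_le.2 hK')

end BratteliDiagram

/-- if an ergodic atomless IRS `φ` gives measure zero to
`⋃_{x̄∈X_{r-1}} F(x̄)`, then it also gives measure zero to `⋃_{x̄∈W_r∖Z_r} F(x̄)`, where `W_r`
consists of the `r`-element subsets of `X` and `Z_r ⊆ W_r` of those whose points lie in
pairwise distinct `G`-orbits. -/
theorem phi_Wr_minus_Zr_null (B : BratteliDiagram)
    (hsimple : B.IsSimple) (heven : B.IsEven)
    (r : ℕ) (hr : 1 ≤ r)
    (φ : Measure (Subgroup ↥B.fullGroup)) (hφ : IsErgodicIRS ↥B.fullGroup φ)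
    (hatomless : ∀ H : Subgroup ↥B.fullGroup, φ {H} = 0)
    (hsmall : φ (⋃ (xb : Set B.Path) (_ : xb.Finite ∧ xb.ncard ≤ r - 1), B.FF xb) = 0) :
    φ (⋃ (xb : Set B.Path)
        (_ : (xb.Finite ∧ xb.ncard = r) ∧
          ¬(∀ y ∈ xb, ∀ z ∈ xb, y ≠ z →
            MulAction.orbit ↥B.fullGroup y ≠ MulAction.orbit ↥B.fullGroup z)),
        B.FF xb) = 0 := by
  classical
  have hnull : φ (⋃ n, B.SN r n) = 0 :=
    measure_iUnion_null fun n => B.SN_null heven r hr φ hφ.1 hsmall n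
  refine measure_mono_null ?_ hnull
  intro H hH
  simp only [Set.mem_iUnion] at hH ⊢
  obtain ⟨xb, ⟨⟨hfin, hcard⟩, hnot⟩, hF⟩ := hH
  push Not at hnot
  obtain ⟨y, hy, z, hz, hne, horb⟩ := hnot
  have hmem : y ∈ MulAction.orbit ↥B.fullGroup z := by
    rw [← horb]; exact MulAction.mem_orbit_self y
  obtain ⟨g, hg⟩ := hmem
  obtain ⟨n, hn⟩ := g.2
  refine ⟨n, hfin.toFinset, ?_, by simpa using hF, y, by simpa using hy, z, by simpa using hz,
    hne, fun i hi => ?_⟩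
  · rw [← Set.ncard_eq_toFinset_card xb hfin, hcard]
  · rw [← hg]
    exact hn.1.1 z i hi
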